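/- Consider a DMC W with finite input alphabet X containing the 'off' symbol 0 and finite output alphabet Y, with Q0 = W(·|0) and supp(Q0) = Y. If the input symbol 0 is redundant, i.e., Q0 lies in the convex hull of {W(·|x) : x ∈ X, x ≠ 0}, then for any δ ≥ 0, lim_{ε↓0} lim_{n→∞} K_n(δ,ε)/n = max I(P,W), where the maximum is over input distributions P on X satisfying P(0) = 0 and Σ_x P(x) W(·|x) = Q0. -/

import Mathlib

open Filter
open scoped BigOperators Topology

/-- `p` is a probability mass function on a finite type. -/
def IsDist {α : Type*} [Fintype α] (p : α → ℝ) : Prop :=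
  (∀ a, 0 ≤ p a) ∧ ∑ a, p a = 1

/-- Relative entropy (in nats) between pmfs on a finite type. -/
noncomputable def relEnt {α : Type*} [Fintype α] (p q : α → ℝ) : ℝ :=
  ∑ a, p a * Real.log (p a / q a)

/-- Output distribution on `Y` induced by input distribution `P` through channel `W`. -/
noncomputable def outDist {X Y : Type*} [Fintype X] (P : X → ℝ) (W : X → Y → ℝ) : Y → ℝ :=
  fun y => ∑ x, P x * W x y

/-- Mutual information `I(P, W)`. -/
noncomputable def mutInfo {X Y : Type*} [Fintype X] [Fintype Y] (P : X → ℝ) (W : X → Y → ℝ) : ℝ :=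
  ∑ x, ∑ y, P x * W x y * Real.log (W x y / outDist P W y)

/-- The output distribution on `Y^n` induced by a random code (a distribution `ρ` over
encoder/decoder pairs) together with a uniformly chosen message, through `n` memoryless
uses of the channel `W`. -/
noncomputable def codeOut {X Y : Type*} [Fintype X] [Fintype Y] [DecidableEq Y]
    (W : X → Y → ℝ) {n m : ℕ}
    (ρ : (Fin m → Fin n → X) × ((Fin n → Y) → Fin m) → ℝ) : (Fin n → Y) → ℝ :=
  fun ys => ∑ c, ρ c * ((m : ℝ)⁻¹ * ∑ j, ∏ i, W (c.1 j i) (ys i))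

/-- Average probability of a decoding error of a random code, the message being uniform. -/
noncomputable def codeErr {X Y : Type*} [Fintype X] [Fintype Y] [DecidableEq Y]
    (W : X → Y → ℝ) {n m : ℕ}
    (ρ : (Fin m → Fin n → X) × ((Fin n → Y) → Fin m) → ℝ) : ℝ :=
  ∑ c, ρ c * ((m : ℝ)⁻¹ * ∑ j, ∑ ys : Fin n → Y,
    if c.2 ys = j then 0 else ∏ i, W (c.1 j i) (ys i))

/-- `Kmax W x0 δ ε n` is the maximum of `log |M|` (in nats) over random codes of
blocklength `n` whose induced output distribution `Q^n` satisfies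
`D(Q^n ‖ Q0^{×n}) ≤ δ` (with `Q0 = W(·|x0)`) and whose average error probability
is at most `ε`. -/
noncomputable def Kmax {X Y : Type*} [Fintype X] [Fintype Y] [DecidableEq Y]
    (W : X → Y → ℝ) (x0 : X) (δ ε : ℝ) (n : ℕ) : ℝ :=
  sSup {k : ℝ | ∃ m : ℕ, 0 < m ∧
    ∃ ρ : (Fin m → Fin n → X) × ((Fin n → Y) → Fin m) → ℝ,
      (∀ c, 0 ≤ ρ c) ∧ (∑ c, ρ c) = 1 ∧
      relEnt (codeOut W ρ) (fun ys : Fin n → Y => ∏ i, W x0 (ys i)) ≤ δ ∧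
      codeErr W ρ ≤ ε ∧ k = Real.log m}

/-- `IsL W x0 δ L` says that `L = lim_{ε↓0} liminf_{n→∞} K_n(δ,ε)/√(nδ)`
(as an extended real, so that `L = ⊤` is allowed). -/
noncomputable def IsL {X Y : Type*} [Fintype X] [Fintype Y] [DecidableEq Y]
    (W : X → Y → ℝ) (x0 : X) (δ : ℝ) (L : EReal) : Prop :=
  Tendsto (fun ε : ℝ =>
      liminf (fun n : ℕ => ((Kmax W x0 δ ε n / Real.sqrt (n * δ) : ℝ) : EReal)) atTop)
    (nhdsWithin 0 (Set.Ioi 0)) (nhds L)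




section Helpers

variable {ι α X Y : Type*} [Fintype ι] [Fintype α] [Fintype X] [Fintype Y]

lemma sum_pi_prod [DecidableEq ι] (F : ι → α → ℝ) :
    ∑ f : ι → α, ∏ i, F i (f i) = ∏ i, ∑ a, F i a := by
  rw [Finset.prod_univ_sum, Fintype.piFinset_univ]

/-- Variational lower bound on the relative entropy. -/
lemma sum_mul_le_relEnt_add {q r : α → ℝ} (hq : IsDist q) (hr : ∀ a, 0 < r a) (h : α → ℝ) :
    ∑ a, q a * h a ≤ relEnt q r + ∑ a, r a * Real.exp (h a) - 1 := by
  rw [← hq.2, relEnt, ← Finset.sum_add_distrib, ← Finset.sum_sub_distrib]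
  refine Finset.sum_le_sum fun a _ => ?_
  have he := Real.exp_pos (h a)
  rcases (hq.1 a).eq_or_lt with h0 | h0
  · rw [← h0]
    have := mul_pos (hr a) he
    simp only [zero_mul, zero_div]
    linarith
  · have hu : 0 < q a / r a := div_pos h0 (hr a)
    have key := Real.log_le_sub_one_of_pos (x := Real.exp (h a) / (q a / r a)) (by positivity)
    rw [Real.log_div he.ne' hu.ne', Real.log_exp] at key
    have := mul_le_mul_of_nonneg_left key h0.le
    have e : q a * (Real.exp (h a) / (q a / r a) - 1) = r a * Real.exp (h a) - q a := by
      have := hr a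
      field_simp
    rw [e] at this
    linarith

lemma relEnt_nonneg {q r : α → ℝ} (hq : IsDist q) (hr : ∀ a, 0 < r a) (hr1 : ∑ a, r a = 1) :
    0 ≤ relEnt q r := by
  have := sum_mul_le_relEnt_add hq hr 0
  simp [hr1] at this
  exact this

/-- Finitely many random variables with means at most `-η < 0` admit a common exponent at which
all their moment generating functions are bounded by some `r < 1`. -/
lemma exists_mgf_le (p g : ι → α → ℝ) (hp : ∀ i, IsDist (p i)) {η : ℝ} (hη : 0 < η)
    (hg : ∀ i, ∑ a, p i a * g i a ≤ -η) :
    ∃ s r : ℝ, 0 < s ∧ 0 < r ∧ r < 1 ∧ ∀ i, ∑ a, p i a * Real.exp (s * g i a) ≤ r := by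
  obtain ⟨B, hB, hgB⟩ : ∃ B : ℝ, 1 ≤ B ∧ ∀ i a, |g i a| ≤ B := by
    refine ⟨1 + ∑ i, ∑ a, |g i a|, ?_, fun i a => ?_⟩
    · have : 0 ≤ ∑ i, ∑ a, |g i a| := by positivity
      linarith
    · have h1 : |g i a| ≤ ∑ a, |g i a| :=
        Finset.single_le_sum (f := fun a => |g i a|) (fun _ _ => abs_nonneg _) (Finset.mem_univ a)
      have h2 : ∑ a, |g i a| ≤ ∑ i, ∑ a, |g i a| :=
        Finset.single_le_sum (f := fun i => ∑ a, |g i a|)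
          (fun _ _ => by positivity) (Finset.mem_univ i)
      linarith
  have hB0 : 0 < B := by linarith
  set s := min (1 / B) (η / (2 * B ^ 2)) with hs
  have hs0 : 0 < s := lt_min (by positivity) (by positivity)
  have hs1 : s * B ≤ 1 := by
    have := min_le_left (1 / B) (η / (2 * B ^ 2))
    rwa [← hs, le_div_iff₀ hB0] at this
  have hs2 : s * (2 * B ^ 2) ≤ η := by
    have := min_le_right (1 / B) (η / (2 * B ^ 2))
    rwa [← hs, le_div_iff₀ (by positivity)] at this
  have hbound : ∀ i, ∑ a, p i a * Real.exp (s * g i a) ≤ 1 - s * η / 2 := by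
    intro i
    have hpt : ∀ a, p i a * Real.exp (s * g i a) ≤
        p i a + s * (p i a * g i a) + p i a * (s ^ 2 * B ^ 2) := by
      intro a
      have h1 : |s * g i a| ≤ s * B := by
        rw [abs_mul, abs_of_pos hs0]
        exact mul_le_mul_of_nonneg_left (hgB i a) hs0.le
      have h2 := (abs_le.1 (Real.abs_exp_sub_one_sub_id_le (h1.trans hs1))).2
      have h3 : (s * g i a) ^ 2 ≤ (s * B) ^ 2 := sq_le_sq' (by linarith [(abs_le.1 h1).1])
        (abs_le.1 h1).2
      calc p i a * Real.exp (s * g i a) ≤ p i a * (1 + s * g i a + s ^ 2 * B ^ 2) := by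
            refine mul_le_mul_of_nonneg_left ?_ ((hp i).1 a)
            nlinarith
        _ = _ := by ring
    calc _ ≤ ∑ a, (p i a + s * (p i a * g i a) + p i a * (s ^ 2 * B ^ 2)) :=
          Finset.sum_le_sum fun a _ => hpt a
      _ = 1 + s * ∑ a, p i a * g i a + s ^ 2 * B ^ 2 := by
          rw [Finset.sum_add_distrib, Finset.sum_add_distrib, ← Finset.mul_sum,
            ← Finset.sum_mul, (hp i).2, one_mul]
      _ ≤ 1 - s * η / 2 := by nlinarith [hg i]
  refine ⟨s, max (1 / 2) (1 - s * η / 2), hs0, by positivity, max_lt (by norm_num) ?_,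
    fun i => (hbound i).trans (le_max_right _ _)⟩
  have := mul_pos hs0 hη
  linarith

lemma isDist_prod {n : ℕ} {p : Fin n → α → ℝ} (hp : ∀ i, IsDist (p i)) :
    IsDist fun ys : Fin n → α => ∏ i, p i (ys i) := by
  refine ⟨fun ys => Finset.prod_nonneg fun i _ => (hp i).1 _, ?_⟩
  rw [sum_pi_prod]
  exact Finset.prod_eq_one fun i _ => (hp i).2

lemma sum_prod_mul_exp_le {n : ℕ} {p g : Fin n → α → ℝ} (hp : ∀ i, IsDist (p i)) {s r : ℝ}
    (h : ∀ i, ∑ a, p i a * Real.exp (s * g i a) ≤ r) :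
    ∑ ys : Fin n → α, (∏ i, p i (ys i)) * Real.exp (s * ∑ i, g i (ys i)) ≤ r ^ n := by
  calc _ = ∑ ys : Fin n → α, ∏ i, (p i (ys i) * Real.exp (s * g i (ys i))) := by
        refine Finset.sum_congr rfl fun ys _ => ?_
        rw [Finset.prod_mul_distrib, Finset.mul_sum, Real.exp_sum]
    _ = ∏ i, ∑ a, p i a * Real.exp (s * g i a) :=
        sum_pi_prod fun i a => p i a * Real.exp (s * g i a)
    _ ≤ ∏ _i : Fin n, r := Finset.prod_le_prod
        (fun i _ => Finset.sum_nonneg fun a _ => mul_nonneg ((hp i).1 a) (Real.exp_pos _).le)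
        fun i _ => h i
    _ = r ^ n := by simp

lemma mutInfo_eq (P : X → ℝ) (W : X → Y → ℝ) {Q : Y → ℝ} (h : outDist P W = Q) :
    mutInfo P W = ∑ x, P x * relEnt (W x) Q := by
  subst h
  simp only [mutInfo, relEnt, Finset.mul_sum, mul_assoc]

section Capacity

variable {W : X → Y → ℝ} {x0 : X} {C : ℝ}

/-- Allowing the redundant symbol does not increase the maximum. -/
lemma sum_relEnt_le (hW : ∀ x, IsDist (W x)) (hsupp : ∀ y, 0 < W x0 y)
    (hmax : IsGreatest {r : ℝ | ∃ P : X → ℝ, IsDist P ∧ P x0 = 0 ∧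
      outDist P W = W x0 ∧ r = mutInfo P W} C)
    {P : X → ℝ} (hP : IsDist P) (hPW : outDist P W = W x0) :
    ∑ x, P x * relEnt (W x) (W x0) ≤ C := by
  classical
  obtain ⟨⟨R, hR, hR0, hRW, hC⟩, hub⟩ := hmax
  have hd : ∀ x, 0 ≤ relEnt (W x) (W x0) := fun x => relEnt_nonneg (hW x) hsupp (hW x0).2
  have hd0 : relEnt (W x0) (W x0) = 0 := by
    simp [relEnt, div_self (hsupp _).ne']
  rw [mutInfo_eq R W hRW] at hC
  have hC0 : 0 ≤ C := hC ▸ Finset.sum_nonneg fun x _ => mul_nonneg (hR.1 x) (hd x)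
  set S : X → ℝ := fun x => P x + P x0 * (R x - if x = x0 then 1 else 0) with hS
  have hsum : ∀ f : X → ℝ, ∑ x, S x * f x = ∑ x, P x * f x + P x0 * (∑ x, R x * f x - f x0) := by
    intro f
    simp only [hS, add_mul, mul_assoc, sub_mul, Finset.sum_add_distrib, ← Finset.mul_sum,
      Finset.sum_sub_distrib, ite_mul, one_mul, zero_mul, Finset.sum_ite_eq', Finset.mem_univ,
      if_true]
  have hSW : outDist S W = W x0 := by
    funext y
    have h1 := congrFun hPW y
    have h2 := congrFun hRW y
    simp only [outDist] at h1 h2 ⊢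
    rw [hsum fun x => W x y, h1, h2]
    ring
  have hle := hub ⟨S, ⟨fun x => ?_, ?_⟩, ?_, hSW, rfl⟩
  · rw [mutInfo_eq S W hSW, hsum, ← hC, hd0] at hle
    nlinarith [mul_nonneg (hP.1 x0) hC0]
  · by_cases hx : x = x0
    · subst hx
      simp [hS, hR0]
    · simp only [hS, if_neg hx, sub_zero]
      exact add_nonneg (hP.1 x) (mul_nonneg (hP.1 x0) (hR.1 x))
  · have := hsum fun _ => 1
    simp only [mul_one, hP.2, hR.2] at this
    linarith
  · simp [hS, hR0]

/-- Approximate Lagrange multipliers for the linear program defining the maximum. -/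
lemma exists_multiplier (hW : ∀ x, IsDist (W x)) (hsupp : ∀ y, 0 < W x0 y)
    (hmax : IsGreatest {r : ℝ | ∃ P : X → ℝ, IsDist P ∧ P x0 = 0 ∧
      outDist P W = W x0 ∧ r = mutInfo P W} C) {η : ℝ} (hη : 0 < η) :
    ∃ lam : Y → ℝ, ∑ y, W x0 y * lam y = 0 ∧
      ∀ x, relEnt (W x) (W x0) ≤ C + η + ∑ y, W x y * lam y := by
  classical
  set d : X → ℝ := fun x => relEnt (W x) (W x0) with hd
  let T : (X → ℝ) →ₗ[ℝ] (Y → ℝ) × ℝ :=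
    ∑ x, (LinearMap.proj x : (X → ℝ) →ₗ[ℝ] ℝ).smulRight ((W x, d x) : (Y → ℝ) × ℝ)
  have hT : ∀ P, T P = (outDist P W, ∑ x, P x * d x) := by
    intro P
    simp only [T, LinearMap.sum_apply, LinearMap.smulRight_apply, LinearMap.proj_apply]
    ext y
    · simp [Prod.fst_sum, outDist]
    · simp [Prod.snd_sum]
  have hcont : Continuous T := T.continuous_of_finiteDimensional
  have hconv : Convex ℝ (T '' stdSimplex ℝ X) := (convex_stdSimplex ℝ X).linear_image T
  have hclosed : IsClosed (T '' stdSimplex ℝ X) :=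
    ((isCompact_stdSimplex ℝ X).image hcont).isClosed
  have hnot : ((W x0, C + η) : (Y → ℝ) × ℝ) ∉ T '' stdSimplex ℝ X := by
    rintro ⟨P, hP, hPT⟩
    rw [hT, Prod.mk.injEq] at hPT
    have := sum_relEnt_le hW hsupp hmax hP hPT.1
    linarith [hPT.2]
  obtain ⟨f, u, hf, hfu⟩ := geometric_hahn_banach_closed_point hconv hclosed hnot
  have hfT : ∀ (v : Y → ℝ) (t : ℝ), f (v, t) = ∑ y, v y * f (Pi.single y 1, 0) + t * f (0, 1) := by
    intro v t
    have hv : ((v, t) : (Y → ℝ) × ℝ) =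
        ∑ y, v y • ((Pi.single y 1, 0) : (Y → ℝ) × ℝ) + t • ((0, 1) : (Y → ℝ) × ℝ) := by
      ext y
      · simp [Prod.fst_sum, Finset.sum_apply, Pi.single_apply]
      · simp [Prod.snd_sum]
    conv_lhs => rw [hv]
    simp only [map_add, map_sum, map_smul, smul_eq_mul]
  set c := f (0, 1)
  have hc : 0 < c := by
    obtain ⟨⟨R, hR, hR0, hRW, hC⟩, -⟩ := hmax
    rw [mutInfo_eq R W hRW] at hC
    have h1 := hf _ ⟨R, hR, rfl⟩
    rw [hT, hRW, ← hC, hfT] at h1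
    rw [hfT] at hfu
    nlinarith
  set l : Y → ℝ := fun y => -f (Pi.single y 1, 0) / c with hl
  have hlf : ∀ v : Y → ℝ, ∑ y, v y * f (Pi.single y 1, 0) = -(c * ∑ y, v y * l y) := by
    intro v
    rw [Finset.mul_sum, ← Finset.sum_neg_distrib]
    refine Finset.sum_congr rfl fun y _ => ?_
    simp only [hl]
    field_simp
  refine ⟨fun y => l y - ∑ z, W x0 z * l z, ?_, fun x => ?_⟩
  · simp only [mul_sub, Finset.sum_sub_distrib, ← Finset.sum_mul, (hW x0).2, one_mul, sub_self]
  · simp only [mul_sub, Finset.sum_sub_distrib, ← Finset.sum_mul, (hW x).2, one_mul]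
    have h1 := hf _ ⟨Pi.single x 1, single_mem_stdSimplex ℝ x, rfl⟩
    have h2 : outDist (Pi.single x 1) W = W x := by
      funext y
      simp [outDist, Pi.single_apply]
    have h3 : ∑ z, (Pi.single x 1 : X → ℝ) z * d z = d x := by
      simp [Pi.single_apply]
    rw [hT, h2, h3, hfT, hlf] at h1
    rw [hfT, hlf] at hfu
    have h4 := h1.trans hfu
    have h5 : c * d x < c * (C + η + (∑ y, W x y * l y - ∑ z, W x0 z * l z)) := by linarith
    exact (lt_of_mul_lt_mul_left h5 hc.le).le

end Capacity

section Converse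

lemma mul_sum_ite_le_relEnt {q r : α → ℝ} (hq : IsDist q) (hr : ∀ a, 0 < r a)
    (hr1 : ∑ a, r a = 1) (A : α → Prop) [DecidablePred A] (t : ℝ)
    (hA : ∑ a, (if A a then r a else 0) ≤ Real.exp (-t)) :
    t * ∑ a, (if A a then q a else 0) ≤ relEnt q r + 1 := by
  have h := sum_mul_le_relEnt_add hq hr fun a => if A a then t else 0
  have h1 : ∑ a, q a * (if A a then t else 0) = t * ∑ a, (if A a then q a else 0) := by
    rw [Finset.mul_sum]
    refine Finset.sum_congr rfl fun a _ => ?_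
    split_ifs <;> ring
  have h2 : ∑ a, r a * Real.exp (if A a then t else 0) ≤
      ∑ a, (r a + (if A a then r a else 0) * Real.exp t) := by
    refine Finset.sum_le_sum fun a _ => ?_
    split_ifs
    · linarith [hr a]
    · simp
  rw [Finset.sum_add_distrib, hr1, ← Finset.sum_mul] at h2
  have h3 := mul_le_mul_of_nonneg_right hA (Real.exp_pos t).le
  rw [← Real.exp_add, neg_add_cancel, Real.exp_zero] at h3
  linarith

variable [DecidableEq Y] {W : X → Y → ℝ} {x0 : X} {n m : ℕ}
  {ρ : (Fin m → Fin n → X) × ((Fin n → Y) → Fin m) → ℝ}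

lemma isDist_codeOut (hW : ∀ x, IsDist (W x)) (hm : 0 < m) (hρ : ∀ c, 0 ≤ ρ c)
    (hρ1 : ∑ c, ρ c = 1) : IsDist (codeOut W ρ) := by
  have hm' : (m : ℝ) ≠ 0 := by positivity
  constructor
  · intro ys
    refine Finset.sum_nonneg fun c _ => mul_nonneg (hρ c) (mul_nonneg (by positivity) ?_)
    exact Finset.sum_nonneg fun j _ => Finset.prod_nonneg fun i _ => (hW _).1 _
  · simp only [codeOut]
    rw [Finset.sum_comm, ← hρ1]
    refine Finset.sum_congr rfl fun c _ => ?_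
    rw [← Finset.mul_sum, ← Finset.mul_sum, Finset.sum_comm]
    have : ∀ j, ∑ ys : Fin n → Y, ∏ i, W (c.1 j i) (ys i) = 1 := fun j =>
      (isDist_prod fun i => hW (c.1 j i)).2
    simp [this, hm']

lemma one_sub_codeErr (hW : ∀ x, IsDist (W x)) (hm : 0 < m) (hρ1 : ∑ c, ρ c = 1) :
    1 - codeErr W ρ = ∑ c, ρ c * ((m : ℝ)⁻¹ * ∑ j, ∑ ys : Fin n → Y,
      if c.2 ys = j then ∏ i, W (c.1 j i) (ys i) else 0) := by
  have hm' : (m : ℝ) ≠ 0 := by positivity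
  rw [sub_eq_iff_eq_add, codeErr, ← Finset.sum_add_distrib, ← hρ1]
  refine Finset.sum_congr rfl fun c _ => ?_
  rw [← mul_add, ← mul_add, ← Finset.sum_add_distrib]
  have : ∀ j, (∑ ys : Fin n → Y, if c.2 ys = j then ∏ i, W (c.1 j i) (ys i) else 0) +
      (∑ ys : Fin n → Y, if c.2 ys = j then 0 else ∏ i, W (c.1 j i) (ys i)) = 1 := by
    intro j
    rw [← (isDist_prod fun i => hW (c.1 j i)).2, ← Finset.sum_add_distrib]
    refine Finset.sum_congr rfl fun ys _ => ?_
    split_ifs <;> simp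
  simp [this, hm']

/-- Change of measure from a channel output law to the off-symbol law. -/
lemma prod_le_prod_mul_exp {X Y : Type*} [Fintype Y] {W : X → Y → ℝ} {x0 : X} {n : ℕ}
    (hW : ∀ x, IsDist (W x)) (hsupp : ∀ y, 0 < W x0 y)
    (xs : Fin n → X) (ys : Fin n → Y) :
    ∏ i, W (xs i) (ys i) ≤
      (∏ i, W x0 (ys i)) * Real.exp (∑ i, Real.log (W (xs i) (ys i) / W x0 (ys i))) := by
  rw [Real.exp_sum, ← Finset.prod_mul_distrib]
  refine Finset.prod_le_prod (fun i _ => (hW _).1 _) fun i _ => ?_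
  have h0 := hsupp (ys i)
  rcases ((hW (xs i)).1 (ys i)).eq_or_lt with h | h
  · rw [← h]
    positivity
  · rw [Real.exp_log (div_pos h h0), mul_div_cancel₀ _ h0.ne']

lemma one_sub_codeErr_le (hW : ∀ x, IsDist (W x)) (hsupp : ∀ y, 0 < W x0 y) (hm : 0 < m)
    (hρ : ∀ c, 0 ≤ ρ c) (hρ1 : ∑ c, ρ c = 1) {lam : Y → ℝ} {a b s r : ℝ} (hs : 0 < s)
    (hr : ∀ x, ∑ y, W x y * Real.exp (s * (Real.log (W x y / W x0 y) - lam y - a)) ≤ r) :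
    1 - codeErr W ρ ≤ r ^ n +
      (∑ ys : Fin n → Y, if b < ∑ i, lam (ys i) then codeOut W ρ ys else 0) +
      (m : ℝ)⁻¹ * Real.exp (n * a + b) := by
  have hm' : (m : ℝ) ≠ 0 := by positivity
  set L : X → Y → ℝ := fun x y => Real.log (W x y / W x0 y) with hL
  set E := Real.exp (n * a + b) with hE
  have hpt : ∀ (c : (Fin m → Fin n → X) × ((Fin n → Y) → Fin m)) (j : Fin m) (ys : Fin n → Y),
      (if c.2 ys = j then ∏ i, W (c.1 j i) (ys i) else 0) ≤
        (∏ i, W (c.1 j i) (ys i)) *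
          Real.exp (s * ∑ i, (L (c.1 j i) (ys i) - lam (ys i) - a)) +
        (if b < ∑ i, lam (ys i) then ∏ i, W (c.1 j i) (ys i) else 0) +
        (if c.2 ys = j then E * ∏ i, W x0 (ys i) else 0) := by
    intro c j ys
    have hw : 0 ≤ ∏ i, W (c.1 j i) (ys i) := Finset.prod_nonneg fun i _ => (hW _).1 _
    have hq : 0 < ∏ i, W x0 (ys i) := Finset.prod_pos fun i _ => hsupp _
    have h1 : 0 ≤ (∏ i, W (c.1 j i) (ys i)) *
          Real.exp (s * ∑ i, (L (c.1 j i) (ys i) - lam (ys i) - a)) :=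
      mul_nonneg hw (Real.exp_pos _).le
    have h2 : 0 ≤ E * ∏ i, W x0 (ys i) := by positivity
    by_cases hj : c.2 ys = j
    swap
    · simp only [if_neg hj]
      split_ifs <;> linarith
    simp only [if_pos hj]
    by_cases hb : b < ∑ i, lam (ys i)
    · rw [if_pos hb]
      linarith
    rw [if_neg hb]
    by_cases hg : 0 ≤ ∑ i, (L (c.1 j i) (ys i) - lam (ys i) - a)
    · have := mul_le_mul_of_nonneg_left (Real.one_le_exp (mul_nonneg hs.le hg)) hw
      linarith
    · have h3 := prod_le_prod_mul_exp hW hsupp (c.1 j) ys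
      have h4 : ∑ i, L (c.1 j i) (ys i) ≤ n * a + b := by
        simp only [Finset.sum_sub_distrib, Finset.sum_const, Finset.card_univ, Fintype.card_fin,
          nsmul_eq_mul] at hg
        linarith
      have h5 := mul_le_mul_of_nonneg_left (Real.exp_le_exp.2 h4) hq.le
      linarith
  have hcode : ∀ c : (Fin m → Fin n → X) × ((Fin n → Y) → Fin m),
      ∑ j, ∑ ys : Fin n → Y, (if c.2 ys = j then ∏ i, W (c.1 j i) (ys i) else 0) ≤
        m * r ^ n + (∑ j, ∑ ys : Fin n → Y,
          if b < ∑ i, lam (ys i) then ∏ i, W (c.1 j i) (ys i) else 0) + E := by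
    intro c
    have h1 : ∀ j, ∑ ys : Fin n → Y, (∏ i, W (c.1 j i) (ys i)) *
        Real.exp (s * ∑ i, (L (c.1 j i) (ys i) - lam (ys i) - a)) ≤ r ^ n := fun j =>
      sum_prod_mul_exp_le (p := fun i => W (c.1 j i))
        (g := fun i y => L (c.1 j i) y - lam y - a) (fun i => hW _) fun i => hr _
    have h2 : ∑ j, ∑ ys : Fin n → Y, (if c.2 ys = j then E * ∏ i, W x0 (ys i) else 0) = E := by
      rw [Finset.sum_comm]
      simp only [Finset.sum_ite_eq, Finset.mem_univ, if_true]
      rw [← Finset.mul_sum, (isDist_prod fun _ : Fin n => hW x0).2, mul_one]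
    have h3 := Finset.sum_le_sum fun j (_ : j ∈ Finset.univ) => h1 j
    rw [Finset.sum_const, Finset.card_univ, Fintype.card_fin, nsmul_eq_mul] at h3
    have h4 := Finset.sum_le_sum fun j (_ : j ∈ Finset.univ) =>
      Finset.sum_le_sum fun ys (_ : ys ∈ Finset.univ) => hpt c j ys
    simp only [Finset.sum_add_distrib] at h4
    linarith
  have hout : ∑ c, ρ c * ((m : ℝ)⁻¹ * ∑ j, ∑ ys : Fin n → Y,
      if b < ∑ i, lam (ys i) then ∏ i, W (c.1 j i) (ys i) else 0) =
      ∑ ys : Fin n → Y, if b < ∑ i, lam (ys i) then codeOut W ρ ys else 0 := by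
    have : ∀ ys : Fin n → Y, (if b < ∑ i, lam (ys i) then codeOut W ρ ys else 0) =
        ∑ c, ρ c * ((m : ℝ)⁻¹ * ∑ j,
          if b < ∑ i, lam (ys i) then ∏ i, W (c.1 j i) (ys i) else 0) := by
      intro ys
      split_ifs
      · rfl
      · simp
    simp only [this]
    rw [Finset.sum_comm]
    refine Finset.sum_congr rfl fun c _ => ?_
    rw [← Finset.mul_sum, ← Finset.mul_sum, Finset.sum_comm]
  rw [one_sub_codeErr hW hm hρ1, ← hout]
  calc _ ≤ ∑ c, ρ c * ((m : ℝ)⁻¹ * (m * r ^ n + (∑ j, ∑ ys : Fin n → Y,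
          if b < ∑ i, lam (ys i) then ∏ i, W (c.1 j i) (ys i) else 0) + E)) :=
        Finset.sum_le_sum fun c _ => mul_le_mul_of_nonneg_left
          (mul_le_mul_of_nonneg_left (hcode c) (by positivity)) (hρ c)
    _ = _ := by
        simp only [mul_add, Finset.sum_add_distrib, ← Finset.sum_mul, hρ1, one_mul]
        rw [inv_mul_cancel_left₀ hm']

/-- Strong converse. -/
lemma eventually_log_le {C δ ε η : ℝ} (hW : ∀ x, IsDist (W x)) (hsupp : ∀ y, 0 < W x0 y)
    (hmax : IsGreatest {r : ℝ | ∃ P : X → ℝ, IsDist P ∧ P x0 = 0 ∧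
      outDist P W = W x0 ∧ r = mutInfo P W} C) (hε : ε < 1) (hη : 0 < η) :
    ∀ᶠ n : ℕ in atTop, ∀ m : ℕ, 0 < m →
      ∀ ρ : (Fin m → Fin n → X) × ((Fin n → Y) → Fin m) → ℝ,
      (∀ c, 0 ≤ ρ c) → ∑ c, ρ c = 1 →
      relEnt (codeOut W ρ) (fun ys : Fin n → Y => ∏ i, W x0 (ys i)) ≤ δ →
      codeErr W ρ ≤ ε → Real.log m ≤ n * (C + 4 * η) := by
  obtain ⟨lam, hlam0, hlam⟩ := exists_multiplier hW hsupp hmax hη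
  obtain ⟨s, r, hs, hr0, hr1, hr⟩ := exists_mgf_le W
    (fun x y => Real.log (W x y / W x0 y) - lam y - (C + 2 * η)) hW hη (by
      intro x
      have := hlam x
      simp only [relEnt] at this
      simp only [mul_sub, Finset.sum_sub_distrib, ← Finset.sum_mul, (hW x).2, one_mul]
      linarith)
  obtain ⟨t, u, ht, hu0, hu1, hu⟩ := exists_mgf_le (fun _ : Unit => W x0)
    (fun _ y => lam y - η) (fun _ => hW x0) hη (by
      intro _
      simp only [mul_sub, Finset.sum_sub_distrib, ← Finset.sum_mul, (hW x0).2, one_mul, hlam0]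
      linarith)
  set τ := -Real.log u with hτ
  have hτ0 : 0 < τ := by
    have := Real.log_neg hu0 hu1
    linarith
  have hε4 : 0 < (1 - ε) / 4 := by linarith
  have ev1 : ∀ᶠ n : ℕ in atTop, r ^ n < (1 - ε) / 4 :=
    (tendsto_pow_atTop_nhds_zero_of_lt_one hr0.le hr1).eventually_lt_const hε4
  have ev2 : ∀ᶠ n : ℕ in atTop, (δ + 1) / ((1 - ε) / 4 * τ) ≤ n :=
    tendsto_natCast_atTop_atTop.eventually_ge_atTop _
  have ev3 : ∀ᶠ n : ℕ in atTop, -Real.log ((1 - ε) / 2) / η ≤ n :=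
    tendsto_natCast_atTop_atTop.eventually_ge_atTop _
  filter_upwards [ev1, ev2, ev3, eventually_gt_atTop 0] with n h1 h2 h3 hn m hm ρ hρ hρ1 hD herr
  have hn' : (0 : ℝ) < n := by exact_mod_cast hn
  have hm' : (0 : ℝ) < m := by exact_mod_cast hm
  have hmain := one_sub_codeErr_le (b := n * η) hW hsupp hm hρ hρ1 hs hr
  have hA : ∑ ys : Fin n → Y, (if n * η < ∑ i, lam (ys i) then ∏ i, W x0 (ys i) else 0) ≤
      Real.exp (-(n * τ)) := by
    have hun : Real.exp (-(n * τ)) = u ^ n := by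
      rw [hτ, mul_neg, neg_neg, Real.exp_nat_mul, Real.exp_log hu0]
    rw [hun]
    refine le_trans (Finset.sum_le_sum fun ys _ => ?_)
      (sum_prod_mul_exp_le (n := n) (p := fun _ => W x0) (g := fun _ y => lam y - η)
        (fun _ => hW x0) fun _ => hu ())
    have hq : 0 < ∏ i, W x0 (ys i) := Finset.prod_pos fun i _ => hsupp _
    split_ifs with h
    · refine le_mul_of_one_le_right hq.le (Real.one_le_exp (mul_nonneg ht.le ?_))
      simp only [Finset.sum_sub_distrib, Finset.sum_const, Finset.card_univ, Fintype.card_fin,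
        nsmul_eq_mul]
      linarith
    · positivity
  have hQ := mul_sum_ite_le_relEnt (isDist_codeOut hW hm hρ hρ1)
    (fun ys => Finset.prod_pos fun i _ => hsupp (ys i))
    (isDist_prod fun _ : Fin n => hW x0).2 (fun ys : Fin n → Y => n * η < ∑ i, lam (ys i))
    (n * τ) hA
  set q := ∑ ys : Fin n → Y, if n * η < ∑ i, lam (ys i) then codeOut W ρ ys else 0
  have hq : q ≤ (1 - ε) / 4 := by
    rw [div_le_iff₀ (by positivity)] at h2
    have : n * τ * q ≤ n * τ * ((1 - ε) / 4) := by linarith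
    exact le_of_mul_le_mul_left this (by positivity)
  have hE : (1 - ε) / 2 ≤ (m : ℝ)⁻¹ * Real.exp (n * (C + 2 * η) + n * η) := by linarith
  have hlog := Real.log_le_log (by linarith) hE
  rw [Real.log_mul (by positivity) (Real.exp_pos _).ne', Real.log_exp, Real.log_inv] at hlog
  rw [div_le_iff₀ hη] at h3
  linarith

end Converse

section Achievability

variable {A B : Type*} [Fintype A] [Fintype B]

lemma sum_pi_prod_mul [DecidableEq ι] {p : A → ℝ} (hp : IsDist p) (j : ι) (φ : A → ℝ) :
    ∑ f : ι → A, (∏ i, p (f i)) * φ (f j) = ∑ a, p a * φ a := by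
  have h1 : ∀ f : ι → A, (∏ i, p (f i)) * φ (f j) =
      ∏ i, (p (f i) * if i = j then φ (f i) else 1) := by
    intro f
    rw [Finset.prod_mul_distrib]
    simp
  simp only [h1]
  rw [sum_pi_prod fun i a => p a * if i = j then φ a else 1]
  rw [Finset.prod_eq_single j]
  · simp
  · intro i _ hi
    simp [hi, hp.2]
  · simp

lemma sum_pi_prod_mul_mul [DecidableEq ι] {p : A → ℝ} (hp : IsDist p) {j k : ι} (hjk : j ≠ k)
    (φ ψ : A → ℝ) :
    ∑ f : ι → A, (∏ i, p (f i)) * (φ (f j) * ψ (f k)) =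
      (∑ a, p a * φ a) * ∑ a, p a * ψ a := by
  have h1 : ∀ f : ι → A, (∏ i, p (f i)) * (φ (f j) * ψ (f k)) =
      ∏ i, (p (f i) * ((if i = j then φ (f i) else 1) * if i = k then ψ (f i) else 1)) := by
    intro f
    rw [Finset.prod_mul_distrib, Finset.prod_mul_distrib]
    simp
  simp only [h1]
  rw [sum_pi_prod fun i a => p a * ((if i = j then φ a else 1) * if i = k then ψ a else 1)]
  have h2 : ∀ i, ∑ a, p a * ((if i = j then φ a else 1) * if i = k then ψ a else 1) =
      (if i = j then ∑ a, p a * φ a else 1) * if i = k then ∑ a, p a * ψ a else 1 := by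
    intro i
    by_cases h : i = j
    · subst h
      simp [hjk]
    · by_cases h' : i = k
      · subst h'
        simp [h]
      · simp [h, h', hp.2]
  simp only [h2, Finset.prod_mul_distrib]
  simp

/-- One-shot random coding bound with a threshold decoder; averaged over the random codebook,
the output law is exactly the one induced by `p`. -/
lemma exists_random_code [DecidableEq B] {p : A → ℝ} (hp : IsDist p) {V : A → B → ℝ}
    (hV : ∀ a, IsDist (V a)) (T : A → B → Prop) [∀ a b, Decidable (T a b)] {m : ℕ} (hm : 0 < m) :
    ∃ ρ : (Fin m → A) × (B → Fin m) → ℝ, (∀ c, 0 ≤ ρ c) ∧ ∑ c, ρ c = 1 ∧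
      (∀ b, ∑ c, ρ c * ((m : ℝ)⁻¹ * ∑ j, V (c.1 j) b) = outDist p V b) ∧
      ∑ c, ρ c * ((m : ℝ)⁻¹ * ∑ j, ∑ b, if c.2 b = j then 0 else V (c.1 j) b) ≤
        ∑ a, p a * (∑ b, if T a b then 0 else V a b) +
          (m - 1) * ∑ b, outDist p V b * ∑ a, p a * if T a b then 1 else 0 := by
  classical
  have hm' : (m : ℝ) ≠ 0 := by positivity
  let dec : (Fin m → A) → B → Fin m := fun f b =>
    if h : ∃ j, T (f j) b then h.choose else ⟨0, hm⟩
  have hdec : ∀ f b j, (if dec f b = j then 0 else V (f j) b) ≤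
      (if T (f j) b then 0 else V (f j) b) +
        ∑ k ∈ Finset.univ.erase j, V (f j) b * if T (f k) b then 1 else 0 := by
    intro f b j
    have hv := (hV (f j)).1 b
    have hnn : ∀ k, 0 ≤ V (f j) b * if T (f k) b then 1 else 0 := fun k =>
      mul_nonneg hv (by split_ifs <;> norm_num)
    have hnn' := Finset.sum_nonneg fun k (_ : k ∈ Finset.univ.erase j) => hnn k
    by_cases hT : T (f j) b
    · have hex : ∃ j, T (f j) b := ⟨j, hT⟩
      by_cases hj : dec f b = j
      · simpa [hj, hT] using hnn'
      · have hspec : T (f (dec f b)) b := by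
          simp only [dec, dif_pos hex]
          exact hex.choose_spec
        have := Finset.single_le_sum (fun k _ => hnn k)
          (Finset.mem_erase.2 ⟨hj, Finset.mem_univ (dec f b)⟩)
        rw [if_pos hspec] at this
        rw [if_neg hj, if_pos hT]
        linarith
    · rw [if_neg hT]
      split_ifs <;> linarith
  have hp0 : ∀ f : Fin m → A, 0 ≤ ∏ i, p (f i) := fun f => Finset.prod_nonneg fun i _ => hp.1 _
  let ρ : (Fin m → A) × (B → Fin m) → ℝ := fun c => if c.2 = dec c.1 then ∏ i, p (c.1 i) else 0
  have hsum : ∀ F : (Fin m → A) × (B → Fin m) → ℝ,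
      ∑ c, ρ c * F c = ∑ f : Fin m → A, (∏ i, p (f i)) * F (f, dec f) := by
    intro F
    rw [Fintype.sum_prod_type]
    refine Finset.sum_congr rfl fun f _ => ?_
    simp [ρ, ite_mul]
  refine ⟨ρ, fun c => ?_, ?_, fun b => ?_, ?_⟩
  · simp only [ρ]
    split_ifs
    exacts [hp0 _, le_rfl]
  · have := hsum fun _ => 1
    simp only [mul_one] at this
    rw [this]
    exact (isDist_prod fun _ : Fin m => hp).2
  · rw [hsum]
    have : ∀ f : Fin m → A, (∏ i, p (f i)) * ((m : ℝ)⁻¹ * ∑ j, V (f j) b) =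
        (m : ℝ)⁻¹ * ∑ j, (∏ i, p (f i)) * V (f j) b := by
      intro f
      rw [← Finset.mul_sum]
      ring
    simp only [this]
    rw [← Finset.mul_sum, Finset.sum_comm]
    simp only [fun j => sum_pi_prod_mul hp j fun a => V a b]
    simp [hm', outDist]
  · rw [hsum]
    set e1 := ∑ a, p a * (∑ b, if T a b then 0 else V a b)
    set e2 := ∑ b, outDist p V b * ∑ a, p a * if T a b then 1 else 0 with he2
    have hstep : ∀ f : Fin m → A,
        ∑ j, ∑ b, (if dec f b = j then 0 else V (f j) b) ≤
          ∑ j, ((∑ b, if T (f j) b then 0 else V (f j) b) +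
            ∑ k ∈ Finset.univ.erase j, ∑ b, V (f j) b * if T (f k) b then 1 else 0) := by
      intro f
      refine Finset.sum_le_sum fun j _ => ?_
      rw [Finset.sum_comm, ← Finset.sum_add_distrib]
      exact Finset.sum_le_sum fun b _ => hdec f b j
    have havg : ∀ j : Fin m, ∑ f : Fin m → A, (∏ i, p (f i)) *
        ((∑ b, if T (f j) b then 0 else V (f j) b) +
            ∑ k ∈ Finset.univ.erase j, ∑ b, V (f j) b * if T (f k) b then 1 else 0) =
        e1 + (m - 1) * e2 := by
      intro j
      simp only [mul_add, Finset.sum_add_distrib, Finset.mul_sum (s := Finset.univ.erase j)]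
      rw [sum_pi_prod_mul hp j fun a => ∑ b, if T a b then 0 else V a b]
      congr 1
      rw [Finset.sum_comm]
      have : ∀ k ∈ Finset.univ.erase j, ∑ f : Fin m → A, (∏ i, p (f i)) *
          ∑ b, V (f j) b * (if T (f k) b then 1 else 0) = e2 := by
        intro k hk
        simp only [Finset.mul_sum (s := (Finset.univ : Finset B))]
        rw [Finset.sum_comm, he2]
        refine Finset.sum_congr rfl fun b _ => ?_
        exact sum_pi_prod_mul_mul hp (Finset.ne_of_mem_erase hk).symm (fun a => V a b)
          fun a => if T a b then 1 else 0
      rw [Finset.sum_congr rfl this, Finset.sum_const, Finset.card_erase_of_mem (Finset.mem_univ j),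
        Finset.card_univ, Fintype.card_fin, nsmul_eq_mul, Nat.cast_sub hm, Nat.cast_one]
    calc _ ≤ ∑ f : Fin m → A, (∏ i, p (f i)) * ((m : ℝ)⁻¹ *
            ∑ j, ((∑ b, if T (f j) b then 0 else V (f j) b) +
              ∑ k ∈ Finset.univ.erase j, ∑ b, V (f j) b * if T (f k) b then 1 else 0)) :=
          Finset.sum_le_sum fun f _ => mul_le_mul_of_nonneg_left
            (mul_le_mul_of_nonneg_left (hstep f) (by positivity)) (hp0 f)
      _ = (m : ℝ)⁻¹ * ∑ j : Fin m, ∑ f : Fin m → A, (∏ i, p (f i)) *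
            ((∑ b, if T (f j) b then 0 else V (f j) b) +
              ∑ k ∈ Finset.univ.erase j, ∑ b, V (f j) b * if T (f k) b then 1 else 0) := by
          rw [Finset.sum_comm, Finset.mul_sum]
          refine Finset.sum_congr rfl fun f _ => ?_
          rw [← Finset.mul_sum]
          ring
      _ = e1 + (m - 1) * e2 := by
          simp only [havg, Finset.sum_const, Finset.card_univ, Fintype.card_fin, nsmul_eq_mul]
          rw [inv_mul_cancel_left₀ hm']

variable [DecidableEq Y] {W : X → Y → ℝ} {x0 : X}

lemma outDist_prod {X Y : Type*} [Fintype X] {W : X → Y → ℝ} {x0 : X} {P : X → ℝ} (hPW : outDist P W = W x0) {n : ℕ} (ys : Fin n → Y) :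
    outDist (fun xs : Fin n → X => ∏ i, P (xs i)) (fun xs (ys : Fin n → Y) =>
      ∏ i, W (xs i) (ys i)) ys = ∏ i, W x0 (ys i) := by
  simp only [outDist, ← Finset.prod_mul_distrib]
  rw [sum_pi_prod fun i x => P x * W x (ys i)]
  exact Finset.prod_congr rfl fun i _ => congrFun hPW (ys i)

/-- Random coding with i.i.d. codewords, whose output law is exactly that of the off symbol. -/
lemma exists_code (hW : ∀ x, IsDist (W x)) (hsupp : ∀ y, 0 < W x0 y) {P : X → ℝ}
    (hP : IsDist P) (hPW : outDist P W = W x0) {m n : ℕ} (hm : 0 < m) {a s r : ℝ} (hs : 0 < s)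
    (hr : ∑ x, ∑ y, P x * W x y * Real.exp (s * (a - Real.log (W x y / W x0 y))) ≤ r) :
    ∃ ρ : (Fin m → Fin n → X) × ((Fin n → Y) → Fin m) → ℝ, (∀ c, 0 ≤ ρ c) ∧ ∑ c, ρ c = 1 ∧
      relEnt (codeOut W ρ) (fun ys : Fin n → Y => ∏ i, W x0 (ys i)) = 0 ∧
      codeErr W ρ ≤ r ^ n + (m - 1) * Real.exp (-(n * a)) := by
  classical
  have hp := isDist_prod (n := n) fun _ => hP
  have hV : ∀ xs : Fin n → X, IsDist fun ys : Fin n → Y => ∏ i, W (xs i) (ys i) :=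
    fun xs => isDist_prod fun i => hW (xs i)
  have hq : ∀ ys : Fin n → Y, 0 < ∏ i, W x0 (ys i) := fun ys => Finset.prod_pos fun i _ => hsupp _
  obtain ⟨ρ, hρ, hρ1, hout, herr⟩ := exists_random_code hp hV
    (fun xs ys => (∏ i, W x0 (ys i)) * Real.exp (n * a) < ∏ i, W (xs i) (ys i)) hm
  refine ⟨ρ, hρ, hρ1, ?_, herr.trans (add_le_add ?_ (mul_le_mul_of_nonneg_left ?_ ?_))⟩
  · have : codeOut W ρ = fun ys : Fin n → Y => ∏ i, W x0 (ys i) := by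
      funext ys
      exact (hout ys).trans (outDist_prod hPW ys)
    rw [this, relEnt]
    exact Finset.sum_eq_zero fun ys _ => by rw [div_self (hq ys).ne', Real.log_one, mul_zero]
  · have hpt : ∀ (xs : Fin n → X) (ys : Fin n → Y),
        (if (∏ i, W x0 (ys i)) * Real.exp (n * a) < ∏ i, W (xs i) (ys i) then 0
          else ∏ i, W (xs i) (ys i)) ≤
        (∏ i, W (xs i) (ys i)) *
          Real.exp (s * ∑ i, (a - Real.log (W (xs i) (ys i) / W x0 (ys i)))) := by
      intro xs ys
      have hw := (hV xs).1 ys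
      split_ifs with h
      · exact mul_nonneg hw (Real.exp_pos _).le
      · rcases hw.eq_or_lt with h0 | h0
        · simp only at h0
          rw [← h0, zero_mul]
        · refine le_mul_of_one_le_right hw (Real.one_le_exp (mul_nonneg hs.le ?_))
          have hne : ∀ i ∈ Finset.univ, W (xs i) (ys i) / W x0 (ys i) ≠ 0 := fun i hi =>
            div_ne_zero (Finset.prod_ne_zero_iff.1 h0.ne' i hi) (hsupp _).ne'
          have h1 : ∑ i, Real.log (W (xs i) (ys i) / W x0 (ys i)) ≤ n * a := by
            rw [← Real.log_prod hne, Finset.prod_div_distrib]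
            rw [not_lt, mul_comm, ← div_le_iff₀ (hq ys)] at h
            exact (Real.log_le_log (div_pos h0 (hq ys)) h).trans_eq (Real.log_exp _)
          simp only [Finset.sum_sub_distrib, Finset.sum_const, Finset.card_univ,
            Fintype.card_fin, nsmul_eq_mul]
          linarith
    calc _ ≤ ∑ xs : Fin n → X, (∏ i, P (xs i)) * ∑ ys : Fin n → Y, (∏ i, W (xs i) (ys i)) *
          Real.exp (s * ∑ i, (a - Real.log (W (xs i) (ys i) / W x0 (ys i)))) :=
          Finset.sum_le_sum fun xs _ => mul_le_mul_of_nonneg_left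
            (Finset.sum_le_sum fun ys _ => hpt xs ys) (hp.1 xs)
      _ = ∑ xs : Fin n → X, ∏ i, (P (xs i) * ∑ y, W (xs i) y *
          Real.exp (s * (a - Real.log (W (xs i) y / W x0 y)))) := by
          refine Finset.sum_congr rfl fun xs _ => ?_
          rw [Finset.prod_mul_distrib, ← sum_pi_prod fun i y => W (xs i) y *
            Real.exp (s * (a - Real.log (W (xs i) y / W x0 y)))]
          congr 1
          refine Finset.sum_congr rfl fun ys _ => ?_
          rw [Finset.prod_mul_distrib, Finset.mul_sum, Real.exp_sum]
      _ = (∑ x, ∑ y, P x * W x y * Real.exp (s * (a - Real.log (W x y / W x0 y)))) ^ n := by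
          rw [sum_pi_prod fun (_ : Fin n) x => P x * ∑ y, W x y *
            Real.exp (s * (a - Real.log (W x y / W x0 y)))]
          simp [Finset.mul_sum, mul_assoc]
      _ ≤ r ^ n := by
          refine pow_le_pow_left₀ (Finset.sum_nonneg fun x _ => Finset.sum_nonneg fun y _ => ?_) hr n
          exact mul_nonneg (mul_nonneg (hP.1 x) ((hW x).1 y)) (Real.exp_pos _).le
  · have hpt : ∀ (ys : Fin n → Y) (xs : Fin n → X), (∏ i, W x0 (ys i)) * ((∏ i, P (xs i)) *
        if (∏ i, W x0 (ys i)) * Real.exp (n * a) < ∏ i, W (xs i) (ys i) then 1 else 0) ≤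
        (∏ i, P (xs i)) * (∏ i, W (xs i) (ys i)) * Real.exp (-(n * a)) := by
      intro ys xs
      have h1 := hp.1 xs
      have h2 := (hV xs).1 ys
      simp only at h1 h2
      split_ifs with h
      · have h3 : ∏ i, W x0 (ys i) ≤ (∏ i, W (xs i) (ys i)) * Real.exp (-(n * a)) := by
          rw [Real.exp_neg, ← div_eq_mul_inv, le_div_iff₀ (Real.exp_pos _)]
          exact h.le
        have := mul_le_mul_of_nonneg_left h3 h1
        linarith
      · rw [mul_zero, mul_zero]
        positivity
    simp only [fun ys => outDist_prod (n := n) hPW ys, Finset.mul_sum]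
    calc _ ≤ ∑ ys : Fin n → Y, ∑ xs : Fin n → X,
          (∏ i, P (xs i)) * (∏ i, W (xs i) (ys i)) * Real.exp (-(n * a)) :=
          Finset.sum_le_sum fun ys _ => Finset.sum_le_sum fun xs _ => hpt ys xs
      _ = (∑ ys : Fin n → Y, ∏ i, W x0 (ys i)) * Real.exp (-(n * a)) := by
          rw [Finset.sum_mul]
          refine Finset.sum_congr rfl fun ys _ => ?_
          rw [← Finset.sum_mul, ← outDist_prod hPW ys, outDist]
      _ = Real.exp (-(n * a)) := by rw [(isDist_prod fun _ : Fin n => hW x0).2, one_mul]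
  · rw [sub_nonneg]
    exact_mod_cast hm

lemma eventually_exists_code {C ε η : ℝ} (hW : ∀ x, IsDist (W x)) (hsupp : ∀ y, 0 < W x0 y)
    {P : X → ℝ} (hP : IsDist P) (hPW : outDist P W = W x0) (hC : C = mutInfo P W)
    (hε : 0 < ε) (hη : 0 < η) :
    ∀ᶠ n : ℕ in atTop, ∃ m : ℕ, 0 < m ∧
      ∃ ρ : (Fin m → Fin n → X) × ((Fin n → Y) → Fin m) → ℝ, (∀ c, 0 ≤ ρ c) ∧ ∑ c, ρ c = 1 ∧
      relEnt (codeOut W ρ) (fun ys : Fin n → Y => ∏ i, W x0 (ys i)) = 0 ∧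
      codeErr W ρ ≤ ε ∧ n * (C - 2 * η) ≤ Real.log m := by
  obtain ⟨s, r, hs, hr0, hr1, hr⟩ := exists_mgf_le (fun (_ : Unit) (z : X × Y) => P z.1 * W z.1 z.2)
    (fun _ z => C - η - Real.log (W z.1 z.2 / W x0 z.2)) (fun _ => by
      refine ⟨fun z => mul_nonneg (hP.1 _) ((hW _).1 _), ?_⟩
      rw [Fintype.sum_prod_type]
      simp only [← Finset.mul_sum, (hW _).2, mul_one, hP.2]) hη (fun _ => by
      rw [Fintype.sum_prod_type]
      simp only [mul_sub, Finset.sum_sub_distrib, ← Finset.sum_mul, ← Finset.mul_sum, (hW _).2,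
        mul_one, hP.2, one_mul]
      rw [mutInfo, hPW] at hC
      linarith)
  have hr' := hr ()
  rw [Fintype.sum_prod_type] at hr'
  have ev1 : ∀ᶠ n : ℕ in atTop, r ^ n < ε / 2 :=
    (tendsto_pow_atTop_nhds_zero_of_lt_one hr0.le hr1).eventually_lt_const (by positivity)
  have ev2 : ∀ᶠ n : ℕ in atTop, Real.exp (-η) ^ n < ε / 2 :=
    (tendsto_pow_atTop_nhds_zero_of_lt_one (Real.exp_pos _).le
      (by rw [← Real.exp_zero, Real.exp_lt_exp]; linarith)).eventually_lt_const (by positivity)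
  filter_upwards [ev1, ev2] with n h1 h2
  have hm : 0 < ⌈Real.exp (n * (C - 2 * η))⌉₊ := Nat.ceil_pos.2 (Real.exp_pos _)
  obtain ⟨ρ, hρ, hρ1, hD, herr⟩ := exists_code (n := n) hW hsupp hP hPW hm hs hr'
  refine ⟨_, hm, ρ, hρ, hρ1, hD, herr.trans ?_, ?_⟩
  · have h3 : (⌈Real.exp (n * (C - 2 * η))⌉₊ : ℝ) - 1 ≤ Real.exp (n * (C - 2 * η)) := by
      linarith [Nat.ceil_lt_add_one (Real.exp_pos (n * (C - 2 * η))).le]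
    have h4 := mul_le_mul_of_nonneg_right h3 (Real.exp_pos (-(n * (C - η)))).le
    rw [← Real.exp_add] at h4
    have h5 : Real.exp (n * (C - 2 * η) + -(n * (C - η))) = Real.exp (-η) ^ n := by
      rw [← Real.exp_nat_mul]
      congr 1
      ring
    linarith
  · rw [Real.le_log_iff_exp_le (by exact_mod_cast hm)]
    exact Nat.le_ceil _

end Achievability

section Limits

variable [DecidableEq Y] {W : X → Y → ℝ} {x0 : X} {C δ ε : ℝ}

lemma tendsto_Kmax_div (hW : ∀ x, IsDist (W x)) (hsupp : ∀ y, 0 < W x0 y) (hδ : 0 ≤ δ)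
    (hmax : IsGreatest {r : ℝ | ∃ P : X → ℝ, IsDist P ∧ P x0 = 0 ∧
      outDist P W = W x0 ∧ r = mutInfo P W} C) (hε : 0 < ε) (hε1 : ε < 1) :
    Tendsto (fun n : ℕ => Kmax W x0 δ ε n / n) atTop (𝓝 C) := by
  obtain ⟨P, hP, -, hPW, hC⟩ := hmax.1
  rw [Metric.tendsto_nhds]
  intro κ hκ
  filter_upwards [eventually_log_le (δ := δ) hW hsupp hmax hε1 (η := κ / 8) (by positivity),
    eventually_exists_code hW hsupp hP hPW hC hε (η := κ / 8) (by positivity),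
    eventually_gt_atTop 0] with n hub hlb hn
  have hn' : (0 : ℝ) < n := by exact_mod_cast hn
  obtain ⟨m, hm, ρ, hρ, hρ1, hD, herr, hlog⟩ := hlb
  have hub' : ∀ k ∈ {k : ℝ | ∃ m : ℕ, 0 < m ∧
      ∃ ρ : (Fin m → Fin n → X) × ((Fin n → Y) → Fin m) → ℝ, (∀ c, 0 ≤ ρ c) ∧ (∑ c, ρ c) = 1 ∧
        relEnt (codeOut W ρ) (fun ys : Fin n → Y => ∏ i, W x0 (ys i)) ≤ δ ∧
        codeErr W ρ ≤ ε ∧ k = Real.log m}, k ≤ n * (C + 4 * (κ / 8)) := by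
    rintro k ⟨m, hm, ρ, h1, h2, h3, h4, rfl⟩
    exact hub m hm ρ h1 h2 h3 h4
  have hmem : Real.log m ∈ {k : ℝ | ∃ m : ℕ, 0 < m ∧
      ∃ ρ : (Fin m → Fin n → X) × ((Fin n → Y) → Fin m) → ℝ, (∀ c, 0 ≤ ρ c) ∧ (∑ c, ρ c) = 1 ∧
        relEnt (codeOut W ρ) (fun ys : Fin n → Y => ∏ i, W x0 (ys i)) ≤ δ ∧
        codeErr W ρ ≤ ε ∧ k = Real.log m} :=
    ⟨m, hm, ρ, hρ, hρ1, hD.trans_le hδ, herr, rfl⟩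
  have hle : Kmax W x0 δ ε n ≤ n * (C + 4 * (κ / 8)) := csSup_le ⟨_, hmem⟩ hub'
  have hge : Real.log m ≤ Kmax W x0 δ ε n := le_csSup ⟨_, hub'⟩ hmem
  rw [Real.dist_eq, abs_lt]
  constructor
  · have : C - 2 * (κ / 8) ≤ Kmax W x0 δ ε n / n := by
      rw [le_div_iff₀ hn']
      linarith
    linarith
  · have : Kmax W x0 δ ε n / n ≤ C + 4 * (κ / 8) := by
      rw [div_le_iff₀ hn']
      linarith
    linarith

/-- With no constraint on the error probability the set defining `Kmax` is unbounded. -/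
lemma Kmax_eq_zero_of_one_le (hW : ∀ x, IsDist (W x)) (hsupp : ∀ y, 0 < W x0 y) (hδ : 0 ≤ δ)
    {P : X → ℝ} (hP : IsDist P) (hPW : outDist P W = W x0) (hε : 1 ≤ ε) (n : ℕ) :
    Kmax W x0 δ ε n = 0 := by
  refine Real.sSup_of_not_bddAbove ?_
  rintro ⟨K, hK⟩
  obtain ⟨m, hm⟩ := exists_nat_gt (Real.exp K)
  have hm0 : 0 < m := by
    have := (Real.exp_pos K).trans hm
    exact_mod_cast this
  obtain ⟨ρ, hρ, hρ1, hD, -⟩ := exists_code (n := n) hW hsupp hP hPW hm0 (a := 0) one_pos le_rfl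
  have herr : codeErr W ρ ≤ 1 := by
    have h0 : 0 ≤ 1 - codeErr W ρ := by
      rw [one_sub_codeErr hW hm0 hρ1]
      refine Finset.sum_nonneg fun c _ => mul_nonneg (hρ c) (mul_nonneg (by positivity) ?_)
      refine Finset.sum_nonneg fun j _ => Finset.sum_nonneg fun ys _ => ?_
      split_ifs
      exacts [Finset.prod_nonneg fun i _ => (hW _).1 _, le_rfl]
    linarith
  have := hK ⟨m, hm0, ρ, hρ, hρ1, hD.trans_le hδ, herr.trans hε, rfl⟩
  rw [Real.log_le_iff_le_exp (by exact_mod_cast hm0)] at this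
  linarith

end Limits

end Helpers

/-!
STATEMENT 0: If the off symbol `x0` is redundant, i.e. `Q0 = W(·|x0)` lies in the convex
hull of `{W(·|x) : x ≠ x0}`, then for any `δ ≥ 0`,
`lim_{ε↓0} lim_{n→∞} K_n(δ,ε)/n = max I(P,W)`, the maximum being over input
distributions `P` with `P(x0) = 0` and `Σ_x P(x) W(·|x) = Q0`.
-/

theorem statement0 {X Y : Type*} [Fintype X] [Fintype Y] [DecidableEq Y]
    (W : X → Y → ℝ) (x0 : X) (hW : ∀ x, IsDist (W x)) (hsupp : ∀ y, 0 < W x0 y)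
    (hred : W x0 ∈ convexHull ℝ (W '' {x : X | x ≠ x0}))
    (δ : ℝ) (hδ : 0 ≤ δ) (Cmax : ℝ)
    (hmax : IsGreatest {r : ℝ | ∃ P : X → ℝ, IsDist P ∧ P x0 = 0 ∧
      outDist P W = W x0 ∧ r = mutInfo P W} Cmax) :
    ∃ F : ℝ → ℝ,
      (∀ ε : ℝ, 0 < ε → Tendsto (fun n : ℕ => Kmax W x0 δ ε n / n) atTop (nhds (F ε))) ∧
      Tendsto F (nhdsWithin 0 (Set.Ioi 0)) (nhds Cmax) := by
  obtain ⟨P, hP, -, hPW, -⟩ := hmax.1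
  refine ⟨fun ε => if ε < 1 then Cmax else 0, fun ε hε => ?_, ?_⟩
  · by_cases h : ε < 1
    · simpa only [if_pos h] using tendsto_Kmax_div hW hsupp hδ hmax hε h
    · simp only [if_neg h, Kmax_eq_zero_of_one_le hW hsupp hδ hP hPW (not_lt.1 h), zero_div]
      exact tendsto_const_nhds
  · refine tendsto_const_nhds.congr' ?_
    filter_upwards [nhdsWithin_le_nhds (Iio_mem_nhds (zero_lt_one' ℝ))] with ε hε
    exact (if_pos hε).symm
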